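/- Let C and L be finite sets of real numbers, and let α, β : C → {0,1} and γ, ω : L → {0,1} be indicator functions each taking the value 1 at exactly one element of their domain, selecting respectively a ∈ C (left border), b ∈ C (right border), c ∈ L (bottom border) and d ∈ L (top border). Let p = (ℓ_p, t_p) ∈ ℝ² be a point and let y ∈ {0,1}. Then the five constraints y ≤ Σ_{c'∈C, c' ≤ ℓ_p} α(c'), y ≤ Σ_{c'∈C, c' ≥ ℓ_p} β(c'), y ≤ Σ_{l∈L, l ≤ t_p} γ(l), y ≤ Σ_{l∈L, l ≥ t_p} ω(l), and Σ_{c'∈C, c' > ℓ_p} α(c') + Σ_{c'∈C, c' < ℓ_p} β(c') + Σ_{l∈L, l > t_p} γ(l) + Σ_{l∈L, l < t_p} ω(l) ≥ 1 − y hold simultaneously if and only if y = 1 exactly when a ≤ ℓ_p ≤ b and c ≤ t_p ≤ d (i.e., y is the indicator that p lies in the rectangle [a,b] × [c,d]). -/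

import Mathlib

theorem sum_filter_indicator_aux (S : Finset ℝ) (f : ℝ → ℝ) (a : ℝ) (ha : a ∈ S)
    (h1 : f a = 1) (h0 : ∀ x ∈ S, x ≠ a → f x = 0) (P : ℝ → Prop) [DecidablePred P] :
    ∑ x ∈ S.filter P, f x = if P a then 1 else 0 := by
  rw [Finset.sum_filter, Finset.sum_eq_single a]
  · rw [h1]
  · intro x hx hne
    rw [h0 x hx hne, ite_self]
  · intro h
    exact absurd ha h

/-- With unique-border indicator variables `α, β` over `C` (selecting `a` and `b`)
and `γ, ω` over `L` (selecting `c` and `d`), and a binary variable `y`, the boundary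
constraints BC₁ together with constraint BC̄₀ hold simultaneously if and only if `y` is the
indicator that the point `p` lies in the rectangle `[a,b] × [c,d]`. -/
theorem boundary_constraints_characterize_membership
    (C L : Finset ℝ) (α β γ ω : ℝ → ℝ)
    (a b : ℝ) (c d : ℝ)
    (haC : a ∈ C) (hbC : b ∈ C) (hcL : c ∈ L) (hdL : d ∈ L)
    (hαa : α a = 1) (hα0 : ∀ c' ∈ C, c' ≠ a → α c' = 0)
    (hβb : β b = 1) (hβ0 : ∀ c' ∈ C, c' ≠ b → β c' = 0)
    (hγc : γ c = 1) (hγ0 : ∀ l ∈ L, l ≠ c → γ l = 0)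
    (hωd : ω d = 1) (hω0 : ∀ l ∈ L, l ≠ d → ω l = 0)
    (p : ℝ × ℝ) (y : ℝ) (hy : y = 0 ∨ y = 1) :
    (y ≤ ∑ c' ∈ C.filter (fun c' => c' ≤ p.1), α c' ∧
      y ≤ ∑ c' ∈ C.filter (fun c' => p.1 ≤ c'), β c' ∧
      y ≤ ∑ l ∈ L.filter (fun l => l ≤ p.2), γ l ∧
      y ≤ ∑ l ∈ L.filter (fun l => p.2 ≤ l), ω l ∧
      1 - y ≤ (∑ c' ∈ C.filter (fun c' => p.1 < c'), α c') +
        (∑ c' ∈ C.filter (fun c' => c' < p.1), β c') +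
        (∑ l ∈ L.filter (fun l => p.2 < l), γ l) +
        (∑ l ∈ L.filter (fun l => l < p.2), ω l)) ↔
      (y = 1 ↔ (a ≤ p.1 ∧ p.1 ≤ b ∧ c ≤ p.2 ∧ p.2 ≤ d)) := by
  rw [sum_filter_indicator_aux C α a haC hαa hα0, sum_filter_indicator_aux C β b hbC hβb hβ0,
    sum_filter_indicator_aux L γ c hcL hγc hγ0, sum_filter_indicator_aux L ω d hdL hωd hω0,
    sum_filter_indicator_aux C α a haC hαa hα0, sum_filter_indicator_aux C β b hbC hβb hβ0,
    sum_filter_indicator_aux L γ c hcL hγc hγ0, sum_filter_indicator_aux L ω d hdL hωd hω0]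
  simp only [← not_le]
  by_cases h1 : a ≤ p.1 <;> by_cases h2 : p.1 ≤ b <;> by_cases h3 : c ≤ p.2 <;>
    by_cases h4 : p.2 ≤ d <;> rcases hy with rfl | rfl <;> simp only [h1, h2, h3, h4] <;> norm_num
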